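/- arXiv:2512.24069 — 6 statements merged into one kernel-verified Lean document; each statement's English description precedes it below -/
import Mathlib

section
/- Let p₁, p₂ ∈ ℝ with 0 < p₁ ≤ 1 and 0 < p₂ ≤ 1, let τ₁ ≥ 1 be an integer, and let p : ℕ → ℝ be the sequence with p(t) = p₁ for 0 ≤ t ≤ τ₁ and p(t) = p₂ for t > τ₁. Then π_j = 2/p₂ for every j ≥ τ₁, and for every j with 0 ≤ j < τ₁, π_j = 2/p₁ − (1 − p₁/2)^{τ₁ − j} · (2/p₁ − 2/p₂). -/
/-- `piSeq p j = ∑_{i > j} ∏_{t=j+1}^{i-1} (1 - p t / 2)`. -/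
noncomputable def piSeq (p : ℕ → ℝ) (j : ℕ) : ℝ :=
  ∑' k : ℕ, ∏ t ∈ Finset.Ico (j + 1) (j + 1 + k), (1 - p t / 2)

/-- If the partial products of `f` starting at `m + 1` sum to `s`, then those starting at `m` sum
to `1 + f m * s`. -/
theorem hasSum_prod_Ico_of_succ {f : ℕ → ℝ} {m : ℕ} {s : ℝ}
    (h : HasSum (fun k : ℕ => ∏ t ∈ Finset.Ico (m + 1) (m + 1 + k), f t) s) :
    HasSum (fun k : ℕ => ∏ t ∈ Finset.Ico m (m + k), f t) (1 + f m * s) := by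
  have hstep : ∀ k : ℕ, ∏ t ∈ Finset.Ico m (m + (k + 1)), f t =
      f m * ∏ t ∈ Finset.Ico (m + 1) (m + 1 + k), f t := fun k => by
    rw [Finset.prod_eq_prod_Ico_succ_bot (by omega), show m + (k + 1) = m + 1 + k by omega]
  have h' : HasSum (fun k : ℕ => ∏ t ∈ Finset.Ico m (m + (k + 1)), f t) (f m * s) := by
    simpa only [hstep] using h.mul_left (f m)
  rw [add_comm]
  simpa using (hasSum_nat_add_iff (f := fun k : ℕ => ∏ t ∈ Finset.Ico m (m + k), f t) 1).mp h'

/-- If `f` is constantly `1 - q / 2` from `m` on, its partial products starting at `m`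
sum to `2 / q`. -/
theorem hasSum_prod_Ico_of_const {f : ℕ → ℝ} {m : ℕ} {q : ℝ} (hq0 : 0 < q) (hq2 : q ≤ 2)
    (hf : ∀ t, m ≤ t → f t = 1 - q / 2) :
    HasSum (fun k : ℕ => ∏ t ∈ Finset.Ico m (m + k), f t) (2 / q) := by
  have hprod : ∀ k : ℕ, ∏ t ∈ Finset.Ico m (m + k), f t = (1 - q / 2) ^ k := fun k => by
    rw [Finset.prod_congr rfl fun t ht => hf t (Finset.mem_Ico.mp ht).1]
    simp
  have hgeom := hasSum_geometric_of_lt_one (r := 1 - q / 2) (by linarith) (by linarith)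
  have hval : (1 - (1 - q / 2))⁻¹ = 2 / q := by
    rw [sub_sub_cancel, inv_div]
  simpa only [hprod, hval] using hgeom

theorem stmt3 (p₁ p₂ : ℝ) (hp₁0 : 0 < p₁) (hp₁1 : p₁ ≤ 1)
    (hp₂0 : 0 < p₂) (hp₂1 : p₂ ≤ 1) (τ₁ : ℕ) (hτ₁ : 1 ≤ τ₁)
    (p : ℕ → ℝ) (hp : ∀ t : ℕ, p t = if t ≤ τ₁ then p₁ else p₂) :
    (∀ j : ℕ, τ₁ ≤ j → piSeq p j = 2 / p₂) ∧
      (∀ j : ℕ, j < τ₁ →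
        piSeq p j = 2 / p₁ - (1 - p₁ / 2) ^ (τ₁ - j) * (2 / p₁ - 2 / p₂)) := by
  have tail : ∀ j : ℕ, τ₁ ≤ j →
      HasSum (fun k : ℕ => ∏ t ∈ Finset.Ico (j + 1) (j + 1 + k), (1 - p t / 2)) (2 / p₂) :=
    fun j hj => hasSum_prod_Ico_of_const hp₂0 (by linarith) fun t ht => by
      rw [hp, if_neg (by omega)]
  have head : ∀ d j : ℕ, j + d = τ₁ →
      HasSum (fun k : ℕ => ∏ t ∈ Finset.Ico (j + 1) (j + 1 + k), (1 - p t / 2))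
        (2 / p₁ - (1 - p₁ / 2) ^ d * (2 / p₁ - 2 / p₂)) := by
    intro d
    induction d with
    | zero =>
      intro j hj
      simpa using tail j (by omega)
    | succ d ih =>
      intro j hj
      have h := hasSum_prod_Ico_of_succ (f := fun t => 1 - p t / 2) (ih (j + 1) (by omega))
      convert h using 1
      rw [hp, if_pos (by omega)]
      field_simp
      ring
  exact ⟨fun j hj => (tail j hj).tsum_eq, fun j hj => (head _ j (by omega)).tsum_eq⟩
end

section
/- Let p₁, p₂ ∈ ℝ with 0 < p₁ ≤ 1 and 0 < p₂ ≤ 1, let τ₁ ≥ 1 be an integer, let T ≥ τ₁ be an integer, and let p : ℕ → ℝ be the sequence with p(t) = p₁ for 0 ≤ t ≤ τ₁ and p(t) = p₂ for t > τ₁. Then Π₁(T) = 2(T − τ₁)/(T p₂) + 2τ₁/(T p₁) − (2/(T p₁) − 2/(T p₂)) · ∑_{j=1}^{τ₁} (1 − p₁/2)^j. -/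
/-- `Π₁(T) = (1/T) ∑_{j=0}^{T-1} π_j`. -/
noncomputable def Pi1 (p : ℕ → ℝ) (T : ℕ) : ℝ :=
  (1 / (T : ℝ)) * ∑ j ∈ Finset.range T, piSeq p j

theorem hasSum_piSeq_of_succ {p : ℕ → ℝ} {j : ℕ} {s : ℝ}
    (h : HasSum (fun k : ℕ => ∏ t ∈ Finset.Ico (j + 2) (j + 2 + k), (1 - p t / 2)) s) :
    HasSum (fun k : ℕ => ∏ t ∈ Finset.Ico (j + 1) (j + 1 + k), (1 - p t / 2))
      (1 + (1 - p (j + 1) / 2) * s) := by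
  rw [← hasSum_nat_add_iff' 1]
  simp only [Finset.sum_range_one, add_zero, Finset.Ico_self, Finset.prod_empty,
    add_sub_cancel_left]
  have hprod (k : ℕ) : ∏ t ∈ Finset.Ico (j + 1) (j + 1 + (k + 1)), (1 - p t / 2) =
      (1 - p (j + 1) / 2) * ∏ t ∈ Finset.Ico (j + 2) (j + 2 + k), (1 - p t / 2) := by
    rw [Finset.prod_eq_prod_Ico_succ_bot (by omega), show j + 1 + (k + 1) = j + 2 + k by omega]
  simpa only [hprod] using h.mul_left (1 - p (j + 1) / 2)

theorem hasSum_piSeq_of_eventually_const {p : ℕ → ℝ} {q : ℝ} (hq0 : 0 < q) (hq1 : q ≤ 1) {j : ℕ}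
    (h : ∀ t, j < t → p t = q) :
    HasSum (fun k : ℕ => ∏ t ∈ Finset.Ico (j + 1) (j + 1 + k), (1 - p t / 2)) (2 / q) := by
  have hg := hasSum_geometric_of_lt_one (r := 1 - q / 2) (by linarith) (by linarith)
  convert hg using 1
  · funext k
    rw [Finset.prod_congr rfl fun t ht => by rw [h t (by simp at ht; omega)]]
    simp
  · rw [sub_sub_cancel, inv_div]

theorem hasSum_piSeq_of_const_upto {p : ℕ → ℝ} {q s : ℝ} (hq : q ≠ 0) {τ : ℕ}
    (hp : ∀ t, t ≤ τ → p t = q)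
    (hs : HasSum (fun k : ℕ => ∏ t ∈ Finset.Ico (τ + 1) (τ + 1 + k), (1 - p t / 2)) s)
    (m j : ℕ) (h : j + m = τ) :
    HasSum (fun k : ℕ => ∏ t ∈ Finset.Ico (j + 1) (j + 1 + k), (1 - p t / 2))
      (2 / q + (s - 2 / q) * (1 - q / 2) ^ m) := by
  induction m generalizing j with
  | zero =>
    obtain rfl : j = τ := by omega
    simpa using hs
  | succ m ih =>
    convert hasSum_piSeq_of_succ (ih (j + 1) (by omega)) using 1
    rw [hp (j + 1) (by omega)]
    field_simp
    ring

theorem stmt4 (p₁ p₂ : ℝ) (hp₁0 : 0 < p₁) (hp₁1 : p₁ ≤ 1)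
    (hp₂0 : 0 < p₂) (hp₂1 : p₂ ≤ 1) (τ₁ T : ℕ) (hτ₁ : 1 ≤ τ₁) (hT : τ₁ ≤ T)
    (p : ℕ → ℝ) (hp : ∀ t : ℕ, p t = if t ≤ τ₁ then p₁ else p₂) :
    Pi1 p T = 2 * ((T : ℝ) - τ₁) / (T * p₂) + 2 * τ₁ / (T * p₁)
      - (2 / (T * p₁) - 2 / (T * p₂)) * ∑ j ∈ Finset.Icc 1 τ₁, (1 - p₁ / 2) ^ j := by
  have htail : ∀ j, τ₁ ≤ j → piSeq p j = 2 / p₂ := fun j hj =>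
    (hasSum_piSeq_of_eventually_const hp₂0 hp₂1
      fun t ht => by rw [hp, if_neg (by omega)]).tsum_eq
  have hhead : ∀ m j, j + m = τ₁ →
      piSeq p j = 2 / p₁ + (2 / p₂ - 2 / p₁) * (1 - p₁ / 2) ^ m := fun m j h =>
    (hasSum_piSeq_of_const_upto hp₁0.ne' (fun t ht => by rw [hp, if_pos ht])
      (hasSum_piSeq_of_eventually_const hp₂0 hp₂1
        fun t ht => by rw [hp, if_neg (by omega)]) m j h).tsum_eq
  have hsum_tail : ∑ j ∈ Finset.Ico τ₁ T, piSeq p j = ((T : ℝ) - τ₁) * (2 / p₂) := by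
    rw [Finset.sum_congr rfl fun j hj => htail j (Finset.mem_Ico.mp hj).1]
    simp [Nat.cast_sub hT]
  have hsum_head : ∑ j ∈ Finset.range τ₁, piSeq p j = τ₁ * (2 / p₁) +
      (2 / p₂ - 2 / p₁) * ∑ j ∈ Finset.Icc 1 τ₁, (1 - p₁ / 2) ^ j := by
    rw [← Finset.sum_range_reflect, Finset.range_eq_Ico, ← Finset.Ico_add_one_right_eq_Icc,
      ← Finset.sum_Ico_add' _ 0 τ₁ 1, Finset.mul_sum,
      Finset.sum_congr rfl fun j hj => hhead (j + 1) _ (by simp at hj; omega),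
      Finset.sum_add_distrib]
    simp
  have hT0 : (T : ℝ) ≠ 0 := by
    have : T ≠ 0 := by omega
    exact_mod_cast this
  rw [Pi1, ← Finset.sum_range_add_sum_Ico _ hT, hsum_head, hsum_tail]
  field_simp
  ring
end

section
/- Let (Ω, 𝓕, P) be a probability space, let m ≥ 1 and T ≥ 1 be integers, let D > 0 be a real number, and let Y : Ω → ℝ be an integrable random variable with Y ≥ 0 almost surely. Assume that for every y > 0, P( Y ≥ T·D + y ) ≤ m · exp( −2y² / (T·D²) ). Then E[Y] ≤ D·( T + m·√(T·π/8) ), where π denotes the circle constant. -/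
open MeasureTheory

/-- A random variable with a Gaussian tail bound beyond the level `a` has mean at most `a` plus
the integral of the tail bound. -/
theorem integral_le_add_of_gaussian_tail {Ω : Type*} [MeasurableSpace Ω] {P : Measure Ω}
    [IsProbabilityMeasure P] {Y : Ω → ℝ} (hint : Integrable Y P) {a b c : ℝ} (hb : 0 < b)
    (htail : ∀ y : ℝ, 0 < y → P.real {ω | a + y ≤ Y ω} ≤ c * Real.exp (-b * y ^ 2)) :
    ∫ ω, Y ω ∂P ≤ a + c * (√(Real.pi / b) / 2) := by
  have hZ : Integrable (fun ω => max (Y ω - a) 0) P := (hint.sub (integrable_const a)).pos_part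
  have hexcess : ∫ ω, max (Y ω - a) 0 ∂P ≤ c * (√(Real.pi / b) / 2) := by
    rw [hZ.integral_eq_integral_meas_le (Filter.Eventually.of_forall fun ω => le_max_right _ _),
      ← integral_gaussian_Ioi, ← integral_const_mul]
    refine integral_mono_of_nonneg (Filter.Eventually.of_forall fun t => measureReal_nonneg)
      ((integrable_exp_neg_mul_sq hb).integrableOn.const_mul c) ?_
    filter_upwards [ae_restrict_mem measurableSet_Ioi] with t ht
    have ht : 0 < t := ht
    have hset : {ω | t ≤ max (Y ω - a) 0} = {ω | a + t ≤ Y ω} := by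
      ext ω
      simp only [Set.mem_ofPred_eq, le_max_iff, not_le.mpr ht, or_false, le_sub_iff_add_le']
    simpa only [hset] using htail t ht
  calc ∫ ω, Y ω ∂P ≤ ∫ ω, (a + max (Y ω - a) 0) ∂P :=
        integral_mono hint ((integrable_const a).add hZ) fun ω => by
          linarith [le_max_left (Y ω - a) 0]
    _ = a + ∫ ω, max (Y ω - a) 0 ∂P := by
        rw [integral_add (integrable_const a) hZ]
        simp
    _ ≤ _ := by gcongr

theorem stmt7 {Ω : Type*} [MeasurableSpace Ω] (P : Measure Ω) [IsProbabilityMeasure P]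
    (m T : ℕ) (hm : 1 ≤ m) (hT : 1 ≤ T) (D : ℝ) (hD : 0 < D)
    (Y : Ω → ℝ) (hint : Integrable Y P) (hpos : ∀ᵐ ω ∂P, 0 ≤ Y ω)
    (htail : ∀ y : ℝ, 0 < y →
      P {ω | (T : ℝ) * D + y ≤ Y ω} ≤
        ENNReal.ofReal ((m : ℝ) * Real.exp (-2 * y ^ 2 / (T * D ^ 2)))) :
    ∫ ω, Y ω ∂P ≤ D * ((T : ℝ) + m * Real.sqrt (T * Real.pi / 8)) := by
  have hT0 : (0 : ℝ) < T := by exact_mod_cast hT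
  have hb : 0 < 2 / ((T : ℝ) * D ^ 2) := by positivity
  have hmean := integral_le_add_of_gaussian_tail (c := (m : ℝ)) hint hb fun y hy => by
    have hexp : -(2 / ((T : ℝ) * D ^ 2)) * y ^ 2 = -2 * y ^ 2 / (T * D ^ 2) := by ring
    rw [hexp]
    exact ENNReal.toReal_le_of_le_ofReal (by positivity) (htail y hy)
  have hsqrt : √(Real.pi / (2 / ((T : ℝ) * D ^ 2))) = 2 * D * √(T * Real.pi / 8) := by
    rw [show Real.pi / (2 / ((T : ℝ) * D ^ 2)) = (2 * D) ^ 2 * (T * Real.pi / 8) by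
      field_simp; ring, Real.sqrt_mul (by positivity), Real.sqrt_sq (by positivity)]
  rw [hsqrt] at hmean
  linarith
end

section
/- Let δ ∈ (0,1) and let p : ℕ → ℝ be a sequence with δ ≤ p(t) ≤ 1 for all t ∈ ℕ. Let Ξ : ℕ → ℝ and a : ℕ → ℝ be sequences with Ξ(t) ≥ 0 and a(t) ≥ 0 for all t, and suppose that for every t ≥ 1, Ξ(t) ≤ (1 − p(t−1)/2)·Ξ(t−1) + a(t−1). Then for every integer T ≥ 1, ∑_{t=1}^T Ξ(t) ≤ π₀·Ξ(0) + ∑_{j=0}^{T−1} π_j · a(j). -/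
/-- The products defining `piSeq` are dominated by a geometric sequence. -/
theorem summable_prod_Ico_one_sub_half {δ : ℝ} (hδ : 0 < δ) {p : ℕ → ℝ}
    (hp : ∀ t, δ ≤ p t ∧ p t ≤ 1) (m : ℕ) :
    Summable fun k : ℕ => ∏ t ∈ Finset.Ico m (m + k), (1 - p t / 2) := by
  have hδ1 : δ ≤ 1 := (hp 0).1.trans (hp 0).2
  refine Summable.of_nonneg_of_le (fun k => ?_) (fun k => ?_)
    (summable_geometric_of_lt_one (r := 1 - δ / 2) (by linarith) (by linarith))
  · exact Finset.prod_nonneg fun t _ => by linarith [(hp t).2]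
  · calc ∏ t ∈ Finset.Ico m (m + k), (1 - p t / 2)
        ≤ ∏ _t ∈ Finset.Ico m (m + k), (1 - δ / 2) :=
          Finset.prod_le_prod (fun t _ => by linarith [(hp t).2])
            (fun t _ => by linarith [(hp t).1])
      _ = (1 - δ / 2) ^ k := by simp

theorem piSeq_nonneg {p : ℕ → ℝ} (hp : ∀ t, p t ≤ 1) (j : ℕ) : 0 ≤ piSeq p j :=
  tsum_nonneg fun _ => Finset.prod_nonneg fun t _ => by linarith [hp t]

theorem piSeq_eq_one_add {δ : ℝ} (hδ : 0 < δ) {p : ℕ → ℝ}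
    (hp : ∀ t, δ ≤ p t ∧ p t ≤ 1) (j : ℕ) :
    piSeq p j = 1 + (1 - p (j + 1) / 2) * piSeq p (j + 1) := by
  unfold piSeq
  rw [(summable_prod_Ico_one_sub_half hδ hp (j + 1)).tsum_eq_zero_add, ← tsum_mul_left]
  congr 1
  · simp
  · refine tsum_congr fun k => ?_
    rw [Finset.prod_eq_prod_Ico_succ_bot (by omega), add_right_comm (j + 1) 1 k, ← add_assoc]

/-- Summation by a potential: the weight `(1 - p T / 2) * piSeq p T` on `Ξ T` absorbs the
contribution of all later terms. -/
theorem sum_Icc_add_le_of_recursion {δ : ℝ} (hδ : 0 < δ) {p : ℕ → ℝ}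
    (hp : ∀ t, δ ≤ p t ∧ p t ≤ 1) {Ξ a : ℕ → ℝ}
    (hrec : ∀ t, Ξ (t + 1) ≤ (1 - p t / 2) * Ξ t + a t) (T : ℕ) :
    ∑ t ∈ Finset.Icc 1 T, Ξ t + (1 - p T / 2) * piSeq p T * Ξ T ≤
      (1 - p 0 / 2) * piSeq p 0 * Ξ 0 + ∑ j ∈ Finset.range T, piSeq p j * a j := by
  induction T with
  | zero => simp
  | succ T ih =>
    rw [Finset.sum_Icc_succ_top (by omega), Finset.sum_range_succ]
    have hstep := mul_le_mul_of_nonneg_left (hrec T) (piSeq_nonneg (fun t => (hp t).2) T)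
    have hsplit : piSeq p T * Ξ (T + 1) =
        Ξ (T + 1) + (1 - p (T + 1) / 2) * piSeq p (T + 1) * Ξ (T + 1) := by
      rw [piSeq_eq_one_add hδ hp T]; ring
    linarith

theorem stmt9 (δ : ℝ) (hδ0 : 0 < δ) (hδ1 : δ < 1) (p : ℕ → ℝ)
    (hp : ∀ t : ℕ, δ ≤ p t ∧ p t ≤ 1)
    (Ξ a : ℕ → ℝ) (hΞ : ∀ t, 0 ≤ Ξ t) (ha : ∀ t, 0 ≤ a t)
    (hrec : ∀ t : ℕ, 1 ≤ t → Ξ t ≤ (1 - p (t - 1) / 2) * Ξ (t - 1) + a (t - 1)) :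
    ∀ T : ℕ, 1 ≤ T →
      ∑ t ∈ Finset.Icc 1 T, Ξ t ≤
        piSeq p 0 * Ξ 0 + ∑ j ∈ Finset.range T, piSeq p j * a j := by
  intro T _
  have hnonneg : ∀ j, 0 ≤ piSeq p j := piSeq_nonneg fun t => (hp t).2
  have hsum := sum_Icc_add_le_of_recursion hδ0 hp
    (fun t => by simpa using hrec (t + 1) (by omega)) T
  have htail : 0 ≤ (1 - p T / 2) * piSeq p T * Ξ T :=
    mul_nonneg (mul_nonneg (by linarith [(hp T).2]) (hnonneg T)) (hΞ T)
  have hhead : 0 ≤ p 0 / 2 * (piSeq p 0 * Ξ 0) :=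
    mul_nonneg (by linarith [(hp 0).1]) (mul_nonneg (hnonneg 0) (hΞ 0))
  linarith
end

section
/- Let δ ∈ (0,1), let p : ℕ → ℝ be a sequence with δ ≤ p(t) ≤ 1 for all t ∈ ℕ, and let η ≥ 0, σ ≥ 0, ζ ≥ 0, M₁ ≥ 0, M₂ ≥ 0 be reals. Let e : ℕ → ℝ and Ξ : ℕ → ℝ be sequences with e(t) ≥ 0 and Ξ(t) ≥ 0 for all t, and suppose that for every t ≥ 1, Ξ(t) ≤ (1 − p(t−1)/2)·Ξ(t−1) + 2η²·( (6/p(t−1) + M₁)·(M₂·e(t−1) + ζ²) + σ² ). Define Υ := sup_{j∈ℕ} M₂·( 6π_j/p(j) + M₁·π_j ). Then for every integer T ≥ 1, ∑_{t=1}^T Ξ(t) ≤ (1 + π₀)·Ξ(0) + 2η²·Υ·∑_{j=0}^{T−1} e(j) + 2η²·T·( (σ² + M₁ζ²)·Π₁(T) + 6ζ²·Π₂(T) ). -/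
/-- `Π₂(T) = (1/T) ∑_{j=0}^{T-1} π_j / p j`. -/
noncomputable def Pi2 (p : ℕ → ℝ) (T : ℕ) : ℝ :=
  (1 / (T : ℝ)) * ∑ j ∈ Finset.range T, piSeq p j / p j

theorem prod_Ico_one_sub_half_nonneg {p : ℕ → ℝ} (hp : ∀ t, p t ≤ 1) (m n : ℕ) :
    0 ≤ ∏ t ∈ Finset.Ico m n, (1 - p t / 2) :=
  Finset.prod_nonneg fun t _ => by linarith [hp t]

theorem prod_Ico_one_sub_half_le_pow {δ : ℝ} {p : ℕ → ℝ} (hp : ∀ t, δ ≤ p t ∧ p t ≤ 1)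
    (m k : ℕ) : ∏ t ∈ Finset.Ico m (m + k), (1 - p t / 2) ≤ (1 - δ / 2) ^ k := by
  calc ∏ t ∈ Finset.Ico m (m + k), (1 - p t / 2)
      ≤ ∏ _t ∈ Finset.Ico m (m + k), (1 - δ / 2) :=
        Finset.prod_le_prod (fun t _ => by linarith [(hp t).2]) fun t _ => by linarith [(hp t).1]
    _ = (1 - δ / 2) ^ k := by simp

theorem piSeq_le_two_div {δ : ℝ} (hδ : 0 < δ) {p : ℕ → ℝ}
    (hp : ∀ t, δ ≤ p t ∧ p t ≤ 1) (j : ℕ) : piSeq p j ≤ 2 / δ := by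
  have h0 : 0 ≤ 1 - δ / 2 := by linarith [hp 0]
  have h1 : 1 - δ / 2 < 1 := by linarith
  calc piSeq p j ≤ ∑' k : ℕ, (1 - δ / 2) ^ k :=
        (summable_prod_Ico_one_sub_half hδ hp (j + 1)).tsum_le_tsum
          (prod_Ico_one_sub_half_le_pow hp (j + 1)) (summable_geometric_of_lt_one h0 h1)
    _ = 2 / δ := by
        rw [tsum_geometric_of_lt_one h0 h1, sub_sub_cancel, inv_div]

/-- Unrolling a perturbed contraction `x (t + 1) ≤ (1 - p t / 2) x t + b t` and summing over time,
with the contribution of the times after `T` kept on the left. -/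
theorem sum_add_tail_le_of_contraction {δ : ℝ} (hδ : 0 < δ) {p : ℕ → ℝ}
    (hp : ∀ t, δ ≤ p t ∧ p t ≤ 1) {x b : ℕ → ℝ}
    (hx : ∀ t, x (t + 1) ≤ (1 - p t / 2) * x t + b t) (T : ℕ) :
    ∑ t ∈ Finset.Icc 1 T, x t + (1 - p T / 2) * piSeq p T * x T ≤
      (1 - p 0 / 2) * piSeq p 0 * x 0 + ∑ j ∈ Finset.range T, piSeq p j * b j := by
  induction T with
  | zero => simp
  | succ T ih =>
    rw [Finset.sum_Icc_succ_top (by omega), Finset.sum_range_succ]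
    have hstep := mul_le_mul_of_nonneg_left (hx T) (piSeq_nonneg (fun t => (hp t).2) T)
    have hrec : piSeq p T * x (T + 1) =
        x (T + 1) + (1 - p (T + 1) / 2) * piSeq p (T + 1) * x (T + 1) := by
      rw [piSeq_eq_one_add hδ hp T]; ring
    linarith

theorem bddAbove_range_piSeq_weight {δ : ℝ} (hδ : 0 < δ) {p : ℕ → ℝ}
    (hp : ∀ t, δ ≤ p t ∧ p t ≤ 1) {M₁ M₂ : ℝ} (hM₁ : 0 ≤ M₁) (hM₂ : 0 ≤ M₂) :
    BddAbove (Set.range fun j : ℕ => M₂ * (6 * piSeq p j / p j + M₁ * piSeq p j)) := by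
  refine ⟨M₂ * (6 * (2 / δ) / δ + M₁ * (2 / δ)), ?_⟩
  rintro _ ⟨j, rfl⟩
  have h := piSeq_le_two_div hδ hp j
  have hj := (hp j).1
  dsimp only
  gcongr

theorem stmt11 (δ : ℝ) (hδ0 : 0 < δ) (hδ1 : δ < 1) (p : ℕ → ℝ)
    (hp : ∀ t : ℕ, δ ≤ p t ∧ p t ≤ 1)
    (η σ ζ M₁ M₂ : ℝ) (hη : 0 ≤ η) (hσ : 0 ≤ σ) (hζ : 0 ≤ ζ)
    (hM₁ : 0 ≤ M₁) (hM₂ : 0 ≤ M₂)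
    (e Ξ : ℕ → ℝ) (he : ∀ t, 0 ≤ e t) (hΞ : ∀ t, 0 ≤ Ξ t)
    (hrec : ∀ t : ℕ, 1 ≤ t →
      Ξ t ≤ (1 - p (t - 1) / 2) * Ξ (t - 1) +
        2 * η ^ 2 * ((6 / p (t - 1) + M₁) * (M₂ * e (t - 1) + ζ ^ 2) + σ ^ 2))
    (Υ : ℝ) (hΥ : Υ = ⨆ j : ℕ, M₂ * (6 * piSeq p j / p j + M₁ * piSeq p j)) :
    ∀ T : ℕ, 1 ≤ T →
      ∑ t ∈ Finset.Icc 1 T, Ξ t ≤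
        (1 + piSeq p 0) * Ξ 0 + 2 * η ^ 2 * Υ * ∑ j ∈ Finset.range T, e j +
          2 * η ^ 2 * T * ((σ ^ 2 + M₁ * ζ ^ 2) * Pi1 p T + 6 * ζ ^ 2 * Pi2 p T) := by
  intro T hT
  have hT0 : (T : ℝ) ≠ 0 := by positivity
  have hπ := piSeq_nonneg fun t => (hp t).2
  have hsum := sum_add_tail_le_of_contraction hδ0 hp (fun t => hrec (t + 1) (by omega)) T
  simp only [Nat.add_sub_cancel] at hsum
  have htail : 0 ≤ (1 - p T / 2) * piSeq p T * Ξ T :=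
    mul_nonneg (mul_nonneg (by linarith [(hp T).2]) (hπ T)) (hΞ T)
  have hinit : (1 - p 0 / 2) * piSeq p 0 * Ξ 0 ≤ (1 + piSeq p 0) * Ξ 0 := by
    refine mul_le_mul_of_nonneg_right ?_ (hΞ 0)
    nlinarith [hπ 0, hp 0]
  have hnoise : ∀ j, piSeq p j * (2 * η ^ 2 * ((6 / p j + M₁) * (M₂ * e j + ζ ^ 2) + σ ^ 2)) ≤
      2 * η ^ 2 * Υ * e j + (2 * η ^ 2 * (σ ^ 2 + M₁ * ζ ^ 2) * piSeq p j +
        2 * η ^ 2 * (6 * ζ ^ 2) * (piSeq p j / p j)) := by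
    intro j
    have hj : M₂ * (6 * piSeq p j / p j + M₁ * piSeq p j) ≤ Υ :=
      hΥ ▸ le_ciSup (bddAbove_range_piSeq_weight hδ0 hp hM₁ hM₂) j
    have h := mul_le_mul_of_nonneg_left (mul_le_mul_of_nonneg_right hj (he j))
      (by positivity : (0 : ℝ) ≤ 2 * η ^ 2)
    calc _ = 2 * η ^ 2 * (M₂ * (6 * piSeq p j / p j + M₁ * piSeq p j) * e j) +
          (2 * η ^ 2 * (σ ^ 2 + M₁ * ζ ^ 2) * piSeq p j +
            2 * η ^ 2 * (6 * ζ ^ 2) * (piSeq p j / p j)) := by ring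
      _ ≤ _ := by linarith
  have hnoise_sum := Finset.sum_le_sum fun j (_ : j ∈ Finset.range T) => hnoise j
  simp only [Finset.sum_add_distrib, ← Finset.mul_sum] at hnoise_sum
  have hPi : 2 * η ^ 2 * T * ((σ ^ 2 + M₁ * ζ ^ 2) * Pi1 p T + 6 * ζ ^ 2 * Pi2 p T) =
      2 * η ^ 2 * (σ ^ 2 + M₁ * ζ ^ 2) * ∑ j ∈ Finset.range T, piSeq p j +
        2 * η ^ 2 * (6 * ζ ^ 2) * ∑ j ∈ Finset.range T, piSeq p j / p j := by
    unfold Pi1 Pi2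
    field_simp
  linarith
end

section
/- Let G be a simple graph on a finite vertex type V and let U ⊆ V. For each i ∈ U let N(i) := ({i} ∪ {j : j adjacent to i in G}) ∩ U (a nonempty finite set since i ∈ N(i)). Define the matrix W ∈ ℝ^{V×V} by: for i ∉ U, W[i,i] = 1 and W[i,j] = W[j,i] = 0 for all j ≠ i; for i ∈ U and j ≠ i, W[i,j] = 1/max(|N(i)|, |N(j)|) if j ∈ U and j is adjacent to i in G, and W[i,j] = 0 otherwise; and for i ∈ U, W[i,i] = 1 − ∑_{j ≠ i} W[i,j]. Then: (a) W is symmetric; (b) every row of W sums to 1; (c) every entry of W is nonnegative (so W is doubly stochastic); and (d) for all i ≠ j, W[i,j] ≠ 0 implies that i and j are adjacent in G. -/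
/-- Feasibility of the Metropolis–Hastings mixing matrix on the subgraph induced by
the activated node set `U`.  Here `N i = ({i} ∪ neighbors of i) ∩ U`. -/
theorem stmt16 {V : Type*} [Fintype V] [DecidableEq V] (G : SimpleGraph V)
    [DecidableRel G.Adj] (U : Finset V)
    (N : V → Finset V) (hN : ∀ i, N i = insert i (G.neighborFinset i) ∩ U)
    (W : Matrix V V ℝ)
    (hdiag_out : ∀ i ∉ U, W i i = 1)
    (hoff_out : ∀ i ∉ U, ∀ j, j ≠ i → W i j = 0 ∧ W j i = 0)
    (hoff_in : ∀ i ∈ U, ∀ j, j ≠ i →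
      W i j = if j ∈ U ∧ G.Adj i j then 1 / (max (N i).card (N j).card : ℝ) else 0)
    (hdiag_in : ∀ i ∈ U, W i i = 1 - ∑ j ∈ Finset.univ.erase i, W i j) :
    (∀ i j, W i j = W j i) ∧
      (∀ i, ∑ j, W i j = 1) ∧
      (∀ i j, 0 ≤ W i j) ∧
      (∀ i j, i ≠ j → W i j ≠ 0 → G.Adj i j) := by
  have hsymm : ∀ i j, W i j = W j i := by
    intro i j
    rcases eq_or_ne j i with rfl | hji
    · rfl
    by_cases hi : i ∈ U
    · by_cases hj : j ∈ U
      · rw [hoff_in i hi j hji, hoff_in j hj i hji.symm]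
        simp [hi, hj, G.adj_comm, max_comm]
      · obtain ⟨h₁, h₂⟩ := hoff_out j hj i hji.symm
        rw [h₁, h₂]
    · obtain ⟨h₁, h₂⟩ := hoff_out i hi j hji
      rw [h₁, h₂]
  have hsum : ∀ i, ∑ j, W i j = 1 := by
    intro i
    rw [← Finset.add_sum_erase _ _ (Finset.mem_univ i)]
    by_cases hi : i ∈ U
    · rw [hdiag_in i hi, sub_add_cancel]
    · rw [hdiag_out i hi, Finset.sum_eq_zero, add_zero]
      exact fun j hj => (hoff_out i hi j (Finset.ne_of_mem_erase hj)).1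
  have hoff_le : ∀ i ∈ U, ∑ j ∈ Finset.univ.erase i, W i j ≤ 1 := by
    intro i hi
    have hiN : i ∈ N i := by simp [hN, hi]
    have hpos : (0 : ℝ) < (N i).card := by
      exact_mod_cast Finset.card_pos.mpr ⟨i, hiN⟩
    calc ∑ j ∈ Finset.univ.erase i, W i j
        ≤ ∑ j ∈ Finset.univ.erase i, if j ∈ N i then 1 / ((N i).card : ℝ) else 0 := by
          refine Finset.sum_le_sum fun j hj => ?_
          rw [hoff_in i hi j (Finset.ne_of_mem_erase hj)]
          split_ifs with h h'
          · exact one_div_le_one_div_of_le hpos (le_max_left _ _)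
          · exact absurd (by simp [hN, h.1, h.2]) h'
          · positivity
          · exact le_rfl
      _ ≤ ∑ j, if j ∈ N i then 1 / ((N i).card : ℝ) else 0 := by
          refine Finset.sum_le_sum_of_subset_of_nonneg (Finset.erase_subset _ _) ?_
          intro j _ _
          positivity
      _ = 1 := by
          simp [hpos.ne']
  refine ⟨hsymm, hsum, fun i j => ?_, fun i j hij hW => ?_⟩
  · rcases eq_or_ne j i with rfl | hji
    · by_cases hj : j ∈ U
      · rw [hdiag_in j hj]
        exact sub_nonneg.mpr (hoff_le j hj)
      · rw [hdiag_out j hj]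
        exact zero_le_one
    · by_cases hi : i ∈ U
      · rw [hoff_in i hi j hji]
        positivity
      · exact (hoff_out i hi j hji).1.ge
  · by_cases hi : i ∈ U
    · rw [hoff_in i hi j hij.symm] at hW
      by_contra h
      simp [h] at hW
    · exact absurd (hoff_out i hi j hij.symm).1 hW
end
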